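/- Let f : ℝ² → ℝ be twice continuously differentiable with compact support, and define u : ℝ² → ℝ by u(x) = (1/2π) ∫_{ℝ²} log(‖x − y‖) f(y) dA_y. Then u is twice continuously differentiable on ℝ² and satisfies Poisson's equation ∂²u/∂x₁²(x) + ∂²u/∂x₂²(x) = f(x) for every x ∈ ℝ². -/

import Mathlib

open MeasureTheory Set Real

open Filter Topology Convolution ContinuousLinearMap

/-- A radial function on the plane is locally integrable as soon as its profile is integrable
near the origin against the polar weight. -/
lemma locallyIntegrable_fun_norm_plane {φ : ℝ → ℝ}
    (hφ : ∀ r : ℝ, IntegrableOn (fun s => s * φ s) (Ioo 0 r)) :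
    LocallyIntegrable (fun x : EuclideanSpace ℝ (Fin 2) => φ ‖x‖) := by
  intro x
  refine ⟨Metric.ball 0 (‖x‖ + 1), Metric.isOpen_ball.mem_nhds (by simp), ?_⟩
  rw [integrableOn_fun_norm_addHaar]
  simpa using hφ (‖x‖ + 1)

lemma locallyIntegrable_log_norm_plane :
    LocallyIntegrable (fun x : EuclideanSpace ℝ (Fin 2) => Real.log ‖x‖) :=
  locallyIntegrable_fun_norm_plane fun r =>
    (Real.continuous_mul_log.integrableOn_Icc (a := 0) (b := r)).mono_set Ioo_subset_Icc_self

lemma locallyIntegrable_inv_norm_plane :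
    LocallyIntegrable (fun x : EuclideanSpace ℝ (Fin 2) => ‖x‖⁻¹) :=
  locallyIntegrable_fun_norm_plane (φ := fun s => s⁻¹) fun r => by
    refine IntegrableOn.congr_fun (f := fun _ => (1 : ℝ)) (by simp) (fun s hs => ?_)
      measurableSet_Ioo
    exact (mul_inv_cancel₀ hs.1.ne').symm

lemma MeasureTheory.LocallyIntegrable.integrable_mul_of_hasCompactSupport
    {K φ : EuclideanSpace ℝ (Fin 2) → ℝ} (hK : LocallyIntegrable K) (hφ : Continuous φ)
    (hs : HasCompactSupport φ) :
    Integrable (fun y => K y * φ y) := by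
  simpa [mul_comm] using hK.integrable_smul_left_of_hasCompactSupport hφ hs

/-- The derivative of the logarithm of the norm regularised at the origin. -/
lemma hasFDerivAt_half_log_norm_sq_add {ε : ℝ} (hε : 0 < ε) (y : EuclideanSpace ℝ (Fin 2)) :
    HasFDerivAt (fun z : EuclideanSpace ℝ (Fin 2) => 2⁻¹ * Real.log (‖z‖ ^ 2 + ε))
      ((‖y‖ ^ 2 + ε)⁻¹ • innerSL ℝ y) y := by
  have h : HasFDerivAt (fun z : EuclideanSpace ℝ (Fin 2) => ‖z‖ ^ 2 + ε)
      ((2 : ℝ) • innerSL ℝ y) y :=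
    ((hasStrictFDerivAt_norm_sq y).hasFDerivAt.add_const ε).congr_fderiv (by ext; simp)
  refine ((h.log (by positivity)).const_mul 2⁻¹).congr_fderiv ?_
  ext v
  simp only [smul_apply, smul_eq_mul]
  ring

lemma tendsto_integral_half_log_norm_sq_add {φ : EuclideanSpace ℝ (Fin 2) → ℝ}
    (hφ : Continuous φ) (hs : HasCompactSupport φ) :
    Tendsto (fun ε : ℝ => ∫ y, 2⁻¹ * Real.log (‖y‖ ^ 2 + ε) * φ y) (𝓝[>] 0)
      (𝓝 (∫ y, Real.log ‖y‖ * φ y)) := by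
  have hlog : LocallyIntegrable
      (fun y : EuclideanSpace ℝ (Fin 2) => 2⁻¹ * Real.log (‖y‖ ^ 2 + 1)) := by
    refine Continuous.locallyIntegrable ?_
    exact continuous_const.mul (Continuous.log (by fun_prop) fun y => by positivity)
  have hne : ∀ᵐ y : EuclideanSpace ℝ (Fin 2), y ≠ 0 := by simp [ae_iff]
  have hsq (y : EuclideanSpace ℝ (Fin 2)) : Real.log ‖y‖ = 2⁻¹ * Real.log (‖y‖ ^ 2) := by
    rw [Real.log_pow]; push_cast; ring
  refine tendsto_integral_filter_of_dominated_convergence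
    (fun y => ‖Real.log ‖y‖ * φ y‖ + ‖2⁻¹ * Real.log (‖y‖ ^ 2 + 1) * φ y‖) ?_ ?_ ?_ ?_
  · filter_upwards with ε
    refine AEStronglyMeasurable.mul ?_ hφ.aestronglyMeasurable
    exact Measurable.aestronglyMeasurable (by fun_prop)
  · filter_upwards [Ioo_mem_nhdsGT one_pos] with ε hε
    filter_upwards [hne] with y hy
    have hy' : 0 < ‖y‖ ^ 2 := by positivity
    rw [norm_mul _ (φ y), norm_mul _ (φ y), norm_mul _ (φ y), ← add_mul]
    gcongr
    have h1 : Real.log (‖y‖ ^ 2) ≤ Real.log (‖y‖ ^ 2 + ε) :=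
      Real.log_le_log hy' (by linarith [hε.1])
    have h2 : Real.log (‖y‖ ^ 2 + ε) ≤ Real.log (‖y‖ ^ 2 + 1) :=
      Real.log_le_log (by linarith [hε.1]) (by linarith [hε.2])
    rw [hsq, Real.norm_eq_abs, Real.norm_eq_abs, Real.norm_eq_abs, abs_le]
    constructor <;>
    linarith [neg_abs_le (2⁻¹ * Real.log (‖y‖ ^ 2)), le_abs_self (2⁻¹ * Real.log (‖y‖ ^ 2 + 1)),
      abs_nonneg (2⁻¹ * Real.log (‖y‖ ^ 2)), abs_nonneg (2⁻¹ * Real.log (‖y‖ ^ 2 + 1))]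
  · exact (locallyIntegrable_log_norm_plane.integrable_mul_of_hasCompactSupport hφ hs).norm.add
      (hlog.integrable_mul_of_hasCompactSupport hφ hs).norm
  · filter_upwards [hne] with y hy
    have hy' : ‖y‖ ^ 2 + 0 ≠ 0 := by simpa using hy
    have hc : ContinuousAt (fun ε : ℝ => 2⁻¹ * Real.log (‖y‖ ^ 2 + ε) * φ y) 0 :=
      (continuousAt_const.mul ((by fun_prop : ContinuousAt (fun ε : ℝ => ‖y‖ ^ 2 + ε) 0).log
        hy')).mul continuousAt_const
    have := hc.tendsto.mono_left (nhdsWithin_le_nhds (s := Ioi 0))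
    rwa [add_zero, ← hsq] at this

lemma abs_inv_mul_inner_le {ε : ℝ} (hε : 0 ≤ ε) (y v : EuclideanSpace ℝ (Fin 2)) :
    |(‖y‖ ^ 2 + ε)⁻¹ * inner ℝ y v| ≤ ‖y‖⁻¹ * ‖v‖ := by
  rcases eq_or_ne y 0 with rfl | hy
  · simp
  have hy' : 0 < ‖y‖ := norm_pos_iff.2 hy
  calc |(‖y‖ ^ 2 + ε)⁻¹ * inner ℝ y v| = (‖y‖ ^ 2 + ε)⁻¹ * |inner ℝ y v| := by
        rw [abs_mul, abs_of_nonneg (by positivity)]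
    _ ≤ (‖y‖ ^ 2)⁻¹ * (‖y‖ * ‖v‖) := by
        gcongr
        · linarith
        · exact abs_real_inner_le_norm y v
    _ = ‖y‖⁻¹ * ‖v‖ := by field_simp

lemma integrable_inv_mul_inner_mul {ε : ℝ} (hε : 0 ≤ ε) (v : EuclideanSpace ℝ (Fin 2))
    {φ : EuclideanSpace ℝ (Fin 2) → ℝ} (hφ : Continuous φ) (hs : HasCompactSupport φ) :
    Integrable (fun y => (‖y‖ ^ 2 + ε)⁻¹ * inner ℝ y v * φ y) := by
  refine ((locallyIntegrable_inv_norm_plane.integrable_mul_of_hasCompactSupport hφ hs).norm.mul_const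
    ‖v‖).mono' ?_ ?_
  · exact (Measurable.aestronglyMeasurable (by fun_prop)).mul hφ.aestronglyMeasurable
  · filter_upwards with y
    rw [norm_mul _ (φ y), norm_mul _ (φ y), norm_inv, norm_norm, mul_right_comm]
    gcongr
    exact abs_inv_mul_inner_le hε y v

lemma tendsto_integral_inv_mul_inner_mul (v : EuclideanSpace ℝ (Fin 2))
    {φ : EuclideanSpace ℝ (Fin 2) → ℝ} (hφ : Continuous φ) (hs : HasCompactSupport φ) :
    Tendsto (fun ε : ℝ => ∫ y, (‖y‖ ^ 2 + ε)⁻¹ * inner ℝ y v * φ y) (𝓝[>] 0)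
      (𝓝 (∫ y, (‖y‖ ^ 2)⁻¹ * inner ℝ y v * φ y)) := by
  refine tendsto_integral_filter_of_dominated_convergence
    (fun y => ‖‖y‖⁻¹ * φ y‖ * ‖v‖) ?_ ?_ ?_ ?_
  · filter_upwards with ε
    exact (Measurable.aestronglyMeasurable (by fun_prop)).mul hφ.aestronglyMeasurable
  · filter_upwards [self_mem_nhdsWithin] with ε hε
    filter_upwards with y
    rw [norm_mul _ (φ y), norm_mul _ (φ y), norm_inv, norm_norm, mul_right_comm]
    gcongr
    exact abs_inv_mul_inner_le (le_of_lt hε) y v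
  · exact (locallyIntegrable_inv_norm_plane.integrable_mul_of_hasCompactSupport
      hφ hs).norm.mul_const _
  · filter_upwards with y
    rcases eq_or_ne y 0 with rfl | hy
    · simp
    have hy' : ‖y‖ ^ 2 + 0 ≠ 0 := by simpa using hy
    have hc : ContinuousAt (fun ε : ℝ => (‖y‖ ^ 2 + ε)⁻¹ * inner ℝ y v * φ y) 0 :=
      (((by fun_prop : ContinuousAt (fun ε : ℝ => ‖y‖ ^ 2 + ε) 0).inv₀
        hy').mul continuousAt_const).mul continuousAt_const
    simpa using hc.tendsto.mono_left (nhdsWithin_le_nhds (s := Ioi 0))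

/-- Integration by parts against the logarithm of the norm in the plane. -/
lemma integral_log_norm_mul_fderiv {h : EuclideanSpace ℝ (Fin 2) → ℝ} (hh : ContDiff ℝ 1 h)
    (hs : HasCompactSupport h) (v : EuclideanSpace ℝ (Fin 2)) :
    ∫ y, Real.log ‖y‖ * fderiv ℝ h y v = -∫ y, (‖y‖ ^ 2)⁻¹ * inner ℝ y v * h y := by
  have hc : Continuous fun y => fderiv ℝ h y v :=
    (hh.continuous_fderiv one_ne_zero).clm_apply continuous_const
  have hcs : HasCompactSupport fun y => fderiv ℝ h y v := hs.fderiv_apply (𝕜 := ℝ) v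
  refine tendsto_nhds_unique (tendsto_integral_half_log_norm_sq_add hc hcs) <|
    (tendsto_integral_inv_mul_inner_mul v hh.continuous hs).neg.congr' ?_
  filter_upwards [self_mem_nhdsWithin] with ε hε
  have hd := hasFDerivAt_half_log_norm_sq_add hε
  have hK : Continuous fun y : EuclideanSpace ℝ (Fin 2) => 2⁻¹ * Real.log (‖y‖ ^ 2 + ε) :=
    continuous_iff_continuousAt.2 fun y => (hd y).continuousAt
  have hfd (y) : fderiv ℝ (fun z : EuclideanSpace ℝ (Fin 2) => 2⁻¹ * Real.log (‖z‖ ^ 2 + ε)) y v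
      = (‖y‖ ^ 2 + ε)⁻¹ * inner ℝ y v := by
    rw [(hd y).fderiv]; simp
  rw [integral_mul_fderiv_eq_neg_fderiv_mul_of_integrable]
  · simp only [hfd]
  · simp only [hfd]
    exact integrable_inv_mul_inner_mul (le_of_lt hε) v hh.continuous hs
  · exact hK.locallyIntegrable.integrable_mul_of_hasCompactSupport hc hcs
  · exact hK.locallyIntegrable.integrable_mul_of_hasCompactSupport hh.continuous hs
  · exact fun y _ => (hd y).differentiableAt
  · exact fun y _ => hh.differentiable one_ne_zero y

/-- The unit vector of the plane at angle `θ`. -/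
noncomputable def planeUnitVector (θ : ℝ) : EuclideanSpace ℝ (Fin 2) :=
  !₂[Real.cos θ, Real.sin θ]

lemma norm_planeUnitVector (θ : ℝ) : ‖planeUnitVector θ‖ = 1 := by
  simp [planeUnitVector, EuclideanSpace.norm_eq]

lemma continuous_planeUnitVector : Continuous planeUnitVector := by
  unfold planeUnitVector
  fun_prop

lemma integral_plane_polar (F : EuclideanSpace ℝ (Fin 2) → ℝ) :
    ∫ y, F y = ∫ p in Ioi (0 : ℝ) ×ˢ Ioo (-π) π, p.1 * F (p.1 • planeUnitVector p.2) := by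
  rw [← Complex.orthonormalBasisOneI.measurePreserving_repr.integral_comp
    Complex.orthonormalBasisOneI.repr.toHomeomorph.measurableEmbedding,
    ← Complex.integral_comp_polarCoord_symm]
  refine setIntegral_congr_fun (measurableSet_Ioi.prod measurableSet_Ioo) fun p _ => ?_
  simp only [smul_eq_mul]
  congr 2
  ext i
  fin_cases i <;> simp [planeUnitVector, -Complex.ofReal_cos, -Complex.ofReal_sin]

lemma hasCompactSupport_comp_smul_planeUnitVector {g : EuclideanSpace ℝ (Fin 2) → ℝ}
    (hs : HasCompactSupport g) (θ : ℝ) :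
    HasCompactSupport fun r : ℝ => g (r • planeUnitVector θ) := by
  obtain ⟨R, hR⟩ := hs.isCompact.isBounded.subset_closedBall 0
  refine HasCompactSupport.intro (isCompact_Icc (a := -R) (b := R)) fun r hr => ?_
  refine image_eq_zero_of_notMem_tsupport fun hmem => hr ?_
  simpa [norm_smul, norm_planeUnitVector, abs_le] using hR hmem

/-- The radial derivative of a compactly supported function integrates, against the inverse
norm, to minus `2π` times its value at the origin. -/
lemma integral_inv_norm_sq_mul_fderiv_self {g : EuclideanSpace ℝ (Fin 2) → ℝ}
    (hg : ContDiff ℝ 1 g) (hs : HasCompactSupport g) :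
    ∫ y, (‖y‖ ^ 2)⁻¹ * fderiv ℝ g y y = -(2 * π * g 0) := by
  have hd (θ r : ℝ) : HasDerivAt (fun r : ℝ => g (r • planeUnitVector θ))
      (fderiv ℝ g (r • planeUnitVector θ) (planeUnitVector θ)) r := by
    refine (hg.differentiable one_ne_zero _).hasFDerivAt.comp_hasDerivAt r ?_
    simpa using (hasDerivAt_id r).smul_const (planeUnitVector θ)
  have hc : Continuous fun p : ℝ × ℝ =>
      fderiv ℝ g (p.1 • planeUnitVector p.2) (planeUnitVector p.2) := by
    have hcu := continuous_planeUnitVector.comp (continuous_snd (X := ℝ) (Y := ℝ))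
    exact ((hg.continuous_fderiv one_ne_zero).comp (continuous_fst.smul hcu)).clm_apply hcu
  have hint : IntegrableOn (fun p : ℝ × ℝ =>
      fderiv ℝ g (p.1 • planeUnitVector p.2) (planeUnitVector p.2))
      (Ioi (0 : ℝ) ×ˢ Ioo (-π) π) := by
    obtain ⟨R, hR⟩ := hs.isCompact.isBounded.subset_closedBall 0
    refine IntegrableOn.of_forall_sdiff_eq_zero (s := Icc 0 R ×ˢ Icc (-π) π)
      (hc.continuousOn.integrableOn_compact (isCompact_Icc.prod isCompact_Icc))
      (measurableSet_Ioi.prod measurableSet_Ioo) fun p hp => ?_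
    have hnm : p.1 • planeUnitVector p.2 ∉ tsupport (fderiv ℝ g) := fun hmem => hp.2 <| by
      have h1 := hR (tsupport_fderiv_subset ℝ hmem)
      have h2 : 0 < p.1 := hp.1.1
      simp only [mem_closedBall_zero_iff, norm_smul, norm_planeUnitVector, mul_one,
        Real.norm_eq_abs, abs_of_pos h2] at h1
      exact ⟨⟨h2.le, h1⟩, Ioo_subset_Icc_self hp.1.2⟩
    rw [image_eq_zero_of_notMem_tsupport hnm, zero_apply]
  calc ∫ y, (‖y‖ ^ 2)⁻¹ * fderiv ℝ g y y
      = ∫ p in Ioi (0 : ℝ) ×ˢ Ioo (-π) π,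
          fderiv ℝ g (p.1 • planeUnitVector p.2) (planeUnitVector p.2) := by
        rw [integral_plane_polar]
        refine setIntegral_congr_fun (measurableSet_Ioi.prod measurableSet_Ioo) fun p hp => ?_
        have h2 : p.1 ≠ 0 := (show 0 < p.1 from hp.1).ne'
        simp only [norm_smul, norm_planeUnitVector, mul_one, Real.norm_eq_abs, sq_abs, map_smul,
          smul_eq_mul]
        field_simp
    _ = ∫ q in Ioo (-π) π ×ˢ Ioi (0 : ℝ),
          fderiv ℝ g (q.2 • planeUnitVector q.1) (planeUnitVector q.1) :=
        (setIntegral_prod_swap (μ := (volume : Measure ℝ)) (ν := (volume : Measure ℝ))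
          (Ioi (0 : ℝ)) (Ioo (-π) π) _).symm
    _ = ∫ θ in Ioo (-π) π, ∫ r in Ioi (0 : ℝ),
          fderiv ℝ g (r • planeUnitVector θ) (planeUnitVector θ) :=
        setIntegral_prod (μ := (volume : Measure ℝ)) (ν := (volume : Measure ℝ)) _ hint.swap
    _ = ∫ θ in Ioo (-π) π, -g 0 := by
        refine setIntegral_congr_fun measurableSet_Ioo fun θ _ => ?_
        have hcd : ContDiff ℝ 1 fun r : ℝ => g (r • planeUnitVector θ) :=
          hg.comp (contDiff_id.smul contDiff_const)
        have := (hasCompactSupport_comp_smul_planeUnitVector hs θ).integral_Ioi_deriv_eq hcd 0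
        simpa only [(hd θ _).deriv, zero_smul] using this
    _ = -(2 * π * g 0) := by
        rw [setIntegral_const, Real.volume_real_Ioo_of_le (by linarith [pi_pos]), smul_eq_mul]
        ring

lemma fderiv_const_mul_log_norm_convolution {g : EuclideanSpace ℝ (Fin 2) → ℝ}
    (hg : ContDiff ℝ 1 g) (hs : HasCompactSupport g) (c : ℝ) (x v : EuclideanSpace ℝ (Fin 2)) :
    fderiv ℝ (fun z => c * ((fun y => Real.log ‖y‖) ⋆[mul ℝ ℝ, volume] g) z) x v =
      c * ((fun y => Real.log ‖y‖) ⋆[mul ℝ ℝ, volume] fun y => fderiv ℝ g y v) x := by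
  rw [((hs.hasFDerivAt_convolution_right (mul ℝ ℝ) locallyIntegrable_log_norm_plane hg
    x).const_mul c).fderiv, smul_apply, convolution_precompR_apply _
    locallyIntegrable_log_norm_plane (hs.fderiv ℝ) (hg.continuous_fderiv one_ne_zero), smul_eq_mul]

lemma fderiv_comp_const_sub_apply {h : EuclideanSpace ℝ (Fin 2) → ℝ} (hh : ContDiff ℝ 1 h)
    (x y v : EuclideanSpace ℝ (Fin 2)) :
    fderiv ℝ (fun z => h (x - z)) y v = -fderiv ℝ h (x - y) v := by
  have hd : HasFDerivAt (fun z => h (x - z)) _ y :=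
    (hh.differentiable one_ne_zero (x - y)).hasFDerivAt.comp y ((hasFDerivAt_id y).const_sub x)
  rw [hd.fderiv]
  simp

lemma log_norm_convolution_fderiv {h : EuclideanSpace ℝ (Fin 2) → ℝ} (hh : ContDiff ℝ 1 h)
    (hs : HasCompactSupport h) (x v : EuclideanSpace ℝ (Fin 2)) :
    ((fun y => Real.log ‖y‖) ⋆[mul ℝ ℝ, volume] fun y => fderiv ℝ h y v) x =
      ∫ y, (‖y‖ ^ 2)⁻¹ * inner ℝ y v * h (x - y) := by
  have key := integral_log_norm_mul_fderiv (h := fun y => h (x - y))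
    (hh.comp (contDiff_const.sub contDiff_id))
    (hs.comp_homeomorph (Homeomorph.subLeft x)) v
  rw [convolution_mul, ← neg_inj, ← key, ← integral_neg]
  simp [fderiv_comp_const_sub_apply hh]

/-- The logarithmic kernel inverts the Laplacian, up to the factor `2π`. -/
lemma sum_log_norm_convolution_fderiv_fderiv {f : EuclideanSpace ℝ (Fin 2) → ℝ}
    (hf : ContDiff ℝ 2 f) (hs : HasCompactSupport f) (x : EuclideanSpace ℝ (Fin 2)) :
    ∑ i : Fin 2, ((fun y => Real.log ‖y‖) ⋆[mul ℝ ℝ, volume] fun y =>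
      fderiv ℝ (fun z => fderiv ℝ f z (EuclideanSpace.single i 1)) y
        (EuclideanSpace.single i 1)) x = 2 * π * f x := by
  have hd (v) : ContDiff ℝ 1 fun z => fderiv ℝ f z v :=
    (hf.fderiv_right (m := 1) (by norm_num)).clm_apply contDiff_const
  have hds (v) : HasCompactSupport fun z => fderiv ℝ f z v := hs.fderiv_apply (𝕜 := ℝ) v
  have hg : ContDiff ℝ 1 fun y => f (x - y) :=
    (hf.of_le (by norm_num)).comp (contDiff_const.sub contDiff_id)
  have hgs : HasCompactSupport fun y => f (x - y) := hs.comp_homeomorph (Homeomorph.subLeft x)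
  have key := integral_inv_norm_sq_mul_fderiv_self hg hgs
  rw [sub_zero] at key
  simp only [log_norm_convolution_fderiv (hd _) (hds _)]
  rw [← integral_finsetSum, ← neg_inj, ← key, ← integral_neg]
  · congr with y
    have hy : y = ∑ i : Fin 2, y i • EuclideanSpace.single i (1 : ℝ) := by
      ext j; fin_cases j <;> simp
    have hL := congrArg (fderiv ℝ f (x - y)) hy
    rw [map_sum] at hL
    simp only [map_smul, Fin.sum_univ_two, smul_eq_mul] at hL
    rw [fderiv_comp_const_sub_apply (hf.of_le one_le_two), hL]
    simp [EuclideanSpace.inner_single_right]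
    ring
  · intro i _
    have := integrable_inv_mul_inner_mul le_rfl (EuclideanSpace.single i 1)
      ((hd (EuclideanSpace.single i 1)).continuous.comp (continuous_sub_left x))
      ((hds (EuclideanSpace.single i 1)).comp_homeomorph (Homeomorph.subLeft x))
    simpa using this

/-- **Theorem (free-space Green's function for Poisson's equation).** If
`f : ℝ² → ℝ` is `C²` with compact support, then the Newtonian potential
`u(x) = (1/2π) ∫_{ℝ²} log ‖x − y‖ f(y) dA_y` is `C²` on `ℝ²` and satisfies
`Δu = f` everywhere. -/
theorem newtonian_potential_solves_poisson
    (f : EuclideanSpace ℝ (Fin 2) → ℝ)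
    (hf : ContDiff ℝ 2 f) (hsupp : HasCompactSupport f)
    (u : EuclideanSpace ℝ (Fin 2) → ℝ)
    (hu : ∀ x, u x = (1 / (2 * Real.pi)) * ∫ y, Real.log ‖x - y‖ * f y ∂volume) :
    ContDiff ℝ 2 u ∧
      ∀ x, (∑ i : Fin 2, fderiv ℝ (fun z => fderiv ℝ u z (EuclideanSpace.single i 1)) x
        (EuclideanSpace.single i 1)) = f x := by
  have hu' : u = fun x =>
      1 / (2 * π) * ((fun y => Real.log ‖y‖) ⋆[mul ℝ ℝ, volume] f) x := by
    funext x
    rw [hu, convolution_mul_swap]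
  have hd (v) : ContDiff ℝ 1 fun z => fderiv ℝ f z v :=
    (hf.fderiv_right (m := 1) (by norm_num)).clm_apply contDiff_const
  refine ⟨?_, fun x => ?_⟩
  · rw [hu']
    exact contDiff_const.mul (hsupp.contDiff_convolution_right (n := 2) (mul ℝ ℝ)
      locallyIntegrable_log_norm_plane hf)
  · simp only [hu', fderiv_const_mul_log_norm_convolution (hf.of_le one_le_two) hsupp,
      fderiv_const_mul_log_norm_convolution (hd _) (hsupp.fderiv_apply (𝕜 := ℝ) _)]
    rw [← Finset.mul_sum, sum_log_norm_convolution_fderiv_fderiv hf hsupp]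
    field_simp
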